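/- Let Γ be an ω-categorical model-complete core that has a symmetric polymorphism modulo endomorphisms, i.e., a binary polymorphism f and endomorphisms e₁, e₂ with e₁(f(x,y)) = e₂(f(y,x)) for all x, y. Then for all elements a₁, …, a_n of Γ, the expansion (Γ, a₁, …, a_n) of Γ by the constants a₁, …, a_n also has a symmetric polymorphism modulo endomorphisms: there are a binary polymorphism g of (Γ, a₁, …, a_n) and endomorphisms h₁, h₂ of (Γ, a₁, …, a_n) such that h₁(g(x,y)) = h₂(g(y,x)) for all x, y. -/

import Mathlib

/-! ### Relational structures and primitive positive formulas -/

/-- A relational structure with relation symbols `σ`, arities `ar`, and domain `D`. -/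
structure RelStruct (σ : Type) (ar : σ → ℕ) (D : Type) where
  rel : (s : σ) → (Fin (ar s) → D) → Prop

/-- Primitive positive formulas over the relational signature `(σ, ar)`, with `n` free
variables (built from atomic formulas using only conjunction and existential
quantification). -/
inductive PPFormula (σ : Type) (ar : σ → ℕ) : ℕ → Type
  | eq {n : ℕ} (i j : Fin n) : PPFormula σ ar n
  | rel {n : ℕ} (s : σ) (v : Fin (ar s) → Fin n) : PPFormula σ ar n
  | and {n : ℕ} (φ ψ : PPFormula σ ar n) : PPFormula σ ar n
  | ex {n : ℕ} (φ : PPFormula σ ar (n + 1)) : PPFormula σ ar n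

/-- Satisfaction of a primitive positive formula in a structure, under an assignment. -/
def PPFormula.Realize {σ : Type} {ar : σ → ℕ} {D : Type} (Γ : RelStruct σ ar D) :
    {n : ℕ} → PPFormula σ ar n → (Fin n → D) → Prop
  | _, .eq i j, t => t i = t j
  | _, .rel s v, t => Γ.rel s (fun m => t (v m))
  | _, .and φ ψ, t => φ.Realize Γ t ∧ ψ.Realize Γ t
  | _, .ex φ, t => ∃ d : D, φ.Realize Γ (Fin.snoc t d)

/-- A relation is primitive positive definable in `Γ` if it is the set of solutions of a
primitive positive formula over the signature of `Γ`. -/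
def PPDefinable {σ : Type} {ar : σ → ℕ} {D : Type} (Γ : RelStruct σ ar D) {n : ℕ}
    (R : (Fin n → D) → Prop) : Prop :=
  ∃ φ : PPFormula σ ar n, ∀ t, R t ↔ φ.Realize Γ t

/-- The expansion of a structure by the constants `a 0, …, a (n-1)`, realised as new
singleton unary relations. -/
def RelStruct.withConstants {σ : Type} {ar : σ → ℕ} {D : Type} (Γ : RelStruct σ ar D)
    {n : ℕ} (a : Fin n → D) : RelStruct (σ ⊕ Fin n) (Sum.elim ar fun _ => 1) D where
  rel s := match s with
    | .inl s => fun t => Γ.rel s t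
    | .inr i => fun t : Fin 1 → D => t 0 = a i

/-- Flattening a `k`-tuple of `d`-tuples into a `(k*d)`-tuple. -/
def flattenTuple {D : Type} {k d : ℕ} (ts : Fin k → Fin d → D) : Fin (k * d) → D :=
  fun j => ts (finProdFinEquiv.symm j).1 (finProdFinEquiv.symm j).2

/-- A primitive positive interpretation of the structure `Δ` in the structure `Γ`:
a dimension `dim`, a primitive positive domain formula, primitive positive defining
formulas for equality and for each atomic formula, and a coordinate map, surjective
onto `Δ`, from the `dim`-tuples satisfying the domain formula. -/
structure PPInterpretation {σ₁ : Type} {ar₁ : σ₁ → ℕ} {D : Type} (Γ : RelStruct σ₁ ar₁ D)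
    {σ₂ : Type} {ar₂ : σ₂ → ℕ} {E : Type} (Δ : RelStruct σ₂ ar₂ E) : Type where
  dim : ℕ
  domFml : PPFormula σ₁ ar₁ dim
  eqFml : PPFormula σ₁ ar₁ (2 * dim)
  relFml : (s : σ₂) → PPFormula σ₁ ar₁ (ar₂ s * dim)
  coord : (Fin dim → D) → E
  coord_surj : ∀ e : E, ∃ t, domFml.Realize Γ t ∧ coord t = e
  eq_iff : ∀ t₁ t₂ : Fin dim → D, domFml.Realize Γ t₁ → domFml.Realize Γ t₂ →
    (coord t₁ = coord t₂ ↔ eqFml.Realize Γ (flattenTuple ![t₁, t₂]))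
  rel_iff : ∀ (s : σ₂) (ts : Fin (ar₂ s) → Fin dim → D),
    (∀ i, domFml.Realize Γ (ts i)) →
    (Δ.rel s (fun i => coord (ts i)) ↔ (relFml s).Realize Γ (flattenTuple ts))

/-- The Boolean structure `({0,1}; NAE)`, where `NAE = {0,1}³ \ {(0,0,0),(1,1,1)}`. -/
def NAEStruct : RelStruct Unit (fun _ => 3) Bool where
  rel := fun _ t => (∃ i, t i = true) ∧ (∃ i, t i = false)
/-! ### First-order formulas, ω-categoricity, model-complete cores -/

/-- First-order formulas over the relational signature `(σ, ar)` with `n` free variables. -/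
inductive FOFormula (σ : Type) (ar : σ → ℕ) : ℕ → Type
  | eq {n : ℕ} (i j : Fin n) : FOFormula σ ar n
  | rel {n : ℕ} (s : σ) (v : Fin (ar s) → Fin n) : FOFormula σ ar n
  | not {n : ℕ} (φ : FOFormula σ ar n) : FOFormula σ ar n
  | and {n : ℕ} (φ ψ : FOFormula σ ar n) : FOFormula σ ar n
  | ex {n : ℕ} (φ : FOFormula σ ar (n + 1)) : FOFormula σ ar n

/-- Satisfaction of a first-order formula in a structure, under an assignment. -/
def FOFormula.Realize {σ : Type} {ar : σ → ℕ} {D : Type} (Γ : RelStruct σ ar D) :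
    {n : ℕ} → FOFormula σ ar n → (Fin n → D) → Prop
  | _, .eq i j, t => t i = t j
  | _, .rel s v, t => Γ.rel s (fun m => t (v m))
  | _, .not φ, t => ¬ φ.Realize Γ t
  | _, .and φ ψ, t => φ.Realize Γ t ∧ ψ.Realize Γ t
  | _, .ex φ, t => ∃ d : D, φ.Realize Γ (Fin.snoc t d)

/-- A relation is first-order definable in `Γ` if it is the set of solutions of a
first-order formula over the signature of `Γ`. -/
def FODefinable {σ : Type} {ar : σ → ℕ} {D : Type} (Γ : RelStruct σ ar D) {n : ℕ}
    (R : (Fin n → D) → Prop) : Prop :=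
  ∃ φ : FOFormula σ ar n, ∀ t, R t ↔ φ.Realize Γ t

/-- Isomorphism of relational structures over the same signature. -/
def RelStruct.Isomorphic {σ : Type} {ar : σ → ℕ} {D E : Type}
    (Γ : RelStruct σ ar D) (Δ : RelStruct σ ar E) : Prop :=
  ∃ g : D ≃ E, ∀ (s : σ) (t : Fin (ar s) → D), Γ.rel s t ↔ Δ.rel s (fun i => g (t i))

/-- A countable structure is ω-categorical if all countable models of its first-order
theory are isomorphic (to it). -/
def IsOmegaCategorical {σ : Type} {ar : σ → ℕ} {D : Type} (Γ : RelStruct σ ar D) : Prop :=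
  Countable D ∧ ∀ (E : Type) (Δ : RelStruct σ ar E), Countable E →
    (∀ φ : FOFormula σ ar 0, φ.Realize Γ Fin.elim0 → φ.Realize Δ Fin.elim0) →
    Γ.Isomorphic Δ

/-- A self-map of the domain of `Γ` is an elementary self-embedding if it preserves the
truth of all first-order formulas. -/
def IsElementarySelfEmbedding {σ : Type} {ar : σ → ℕ} {D : Type} (Γ : RelStruct σ ar D)
    (e : D → D) : Prop :=
  ∀ {n : ℕ} (φ : FOFormula σ ar n) (t : Fin n → D),
    φ.Realize Γ t ↔ φ.Realize Γ (fun i => e (t i))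

/-- A homomorphism between relational structures over the same signature. -/
def IsHom {σ : Type} {ar : σ → ℕ} {D E : Type} (Γ : RelStruct σ ar D) (Δ : RelStruct σ ar E)
    (h : D → E) : Prop :=
  ∀ (s : σ) (t : Fin (ar s) → D), Γ.rel s t → Δ.rel s (fun i => h (t i))

/-- Two structures are homomorphically equivalent if there are homomorphisms in both
directions. -/
def HomEquiv {σ : Type} {ar : σ → ℕ} {D E : Type} (Γ : RelStruct σ ar D)
    (Δ : RelStruct σ ar E) : Prop :=
  (∃ h, IsHom Γ Δ h) ∧ (∃ h, IsHom Δ Γ h)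

/-- A structure is a model-complete core if all its endomorphisms are elementary
self-embeddings. -/
def IsModelCompleteCore {σ : Type} {ar : σ → ℕ} {D : Type} (Γ : RelStruct σ ar D) : Prop :=
  ∀ e : D → D, IsHom Γ Γ e → IsElementarySelfEmbedding Γ e
/-! ### Polymorphisms and endomorphisms -/

/-- A `k`-ary operation `f` preserves an `m`-ary relation `R` if applying `f`
componentwise to `k` tuples of `R` yields a tuple of `R`. -/
def PreservesRel {D : Type} {k m : ℕ} (f : (Fin k → D) → D) (R : (Fin m → D) → Prop) : Prop :=
  ∀ ts : Fin k → Fin m → D, (∀ i, R (ts i)) → R (fun j => f (fun i => ts i j))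

/-- A polymorphism of `Γ` is a finitary operation on the domain preserving all
relations of `Γ`. -/
def IsPolymorphism {σ : Type} {ar : σ → ℕ} {D : Type} (Γ : RelStruct σ ar D) {k : ℕ}
    (f : (Fin k → D) → D) : Prop :=
  ∀ s, PreservesRel f (Γ.rel s)

/-- A binary operation as an operation on `Fin 2`-tuples. -/
def binOp {D : Type} (f : D → D → D) : (Fin 2 → D) → D := fun t => f (t 0) (t 1)

/-- An endomorphism of `Γ` (a unary polymorphism). -/
def IsEndomorphism {σ : Type} {ar : σ → ℕ} {D : Type} (Γ : RelStruct σ ar D)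
    (e : D → D) : Prop :=
  ∀ (s : σ) (t : Fin (ar s) → D), Γ.rel s t → Γ.rel s (fun i => e (t i))

/-- `Γ` has a symmetric polymorphism modulo endomorphisms: a binary polymorphism `f`
and endomorphisms `e₁, e₂` with `e₁(f(x,y)) = e₂(f(y,x))` for all `x, y`. -/
def HasSymmetricPolymorphismModEndos {σ : Type} {ar : σ → ℕ} {D : Type}
    (Γ : RelStruct σ ar D) : Prop :=
  ∃ (f : D → D → D) (e₁ e₂ : D → D),
    IsPolymorphism Γ (binOp f) ∧ IsEndomorphism Γ e₁ ∧ IsEndomorphism Γ e₂ ∧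
    ∀ x y, e₁ (f x y) = e₂ (f y x)

namespace SymPol

open Filter

/-- Iterating a sequence of maps, starting with value `d` at time `i`. -/
def thr {D : Type} (e : ℕ → D → D) (i : ℕ) (d : D) : ℕ → D
  | 0 => d
  | k + 1 => if k < i then d else e k (thr e i d k)

theorem thr_le {D : Type} (e : ℕ → D → D) (i : ℕ) (d : D) (k : ℕ) (hk : k ≤ i) :
    thr e i d k = d := by
  cases k with
  | zero => rfl
  | succ k => simp only [thr]; rw [if_pos (by omega)]

theorem thr_succ {D : Type} (e : ℕ → D → D) (i : ℕ) (d : D) (k : ℕ) (hk : i ≤ k) :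
    thr e i d (k + 1) = e k (thr e i d k) := by
  simp only [thr]; rw [if_neg (by omega)]

/-- Eventual threads. -/
def Thread {D : Type} (e : ℕ → D → D) : Type :=
  {x : ℕ → D // ∀ᶠ k in atTop, x (k + 1) = e k (x k)}

def thread {D : Type} (e : ℕ → D → D) (i : ℕ) (d : D) : Thread e :=
  ⟨thr e i d, by
    filter_upwards [eventually_ge_atTop i] with k hk
    exact thr_succ e i d k hk⟩

instance thrSetoid {D : Type} (e : ℕ → D → D) : Setoid (Thread e) where
  r x y := ∀ᶠ k in atTop, x.1 k = y.1 k
  iseqv := ⟨fun x => Eventually.of_forall fun _ => rfl,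
    fun h => h.mono fun _ h => h.symm,
    fun h h' => by filter_upwards [h, h'] with k a b using a.trans b⟩

theorem thr_eq_of {D : Type} (e : ℕ → D → D) (x y : ℕ → D) (i : ℕ)
    (hx : ∀ k, i ≤ k → x (k + 1) = e k (x k)) (hy : ∀ k, i ≤ k → y (k + 1) = e k (y k))
    (h : x i = y i) : ∀ k, i ≤ k → x k = y k := by
  intro k hk
  induction k, hk using Nat.le_induction with
  | base => exact h
  | succ k hk ih => rw [hx k hk, hy k hk, ih]

theorem exists_thread {D : Type} (e : ℕ → D → D) (x : Thread e) :
    ∃ i0, ∀ i, i0 ≤ i → (Quotient.mk (thrSetoid e) (thread e i (x.1 i))) = Quotient.mk _ x := by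
  obtain ⟨i0, h0⟩ := eventually_atTop.1 x.2
  refine ⟨i0, fun i hi => Quotient.sound ?_⟩
  change ∀ᶠ k in atTop, _
  filter_upwards [eventually_ge_atTop i] with k hk
  refine thr_eq_of e _ _ i (fun k hk => thr_succ e i _ k hk) (fun k hk => h0 k (hi.trans hk)) ?_ k hk
  exact thr_le e i _ i le_rfl

variable {σ : Type} {ar : σ → ℕ} {D : Type}

noncomputable def lim (Γ : RelStruct σ ar D) (e : ℕ → D → D) :
    RelStruct σ ar (Quotient (thrSetoid e)) where
  rel s t := ∀ᶠ k in atTop, Γ.rel s (fun m => (t m).out.1 k)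

theorem out_ev (e : ℕ → D → D) (x : Thread e) :
    ∀ᶠ k in atTop, (Quotient.mk (thrSetoid e) x).out.1 k = x.1 k :=
  Quotient.mk_out (s := thrSetoid e) x

theorem ev_tuple {n : ℕ} (e : ℕ → D → D) (x : Fin n → Thread e) :
    ∀ᶠ k in atTop, (fun i => (Quotient.mk (thrSetoid e) (x i)).out.1 k) = fun i => (x i).1 k := by
  have : ∀ᶠ k in atTop, ∀ i, (Quotient.mk (thrSetoid e) (x i)).out.1 k = (x i).1 k :=
    eventually_all.2 fun i => out_ev e (x i)
  filter_upwards [this] with k hk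
  exact funext hk

theorem ev_const {Γ : RelStruct σ ar D} (e : ℕ → D → D)
    (he : ∀ k, IsElementarySelfEmbedding Γ (e k)) {n : ℕ} (φ : FOFormula σ ar n)
    (x : Fin n → Thread e) :
    ∃ k0, ∀ k, k0 ≤ k → (φ.Realize Γ (fun i => (x i).1 k) ↔ φ.Realize Γ (fun i => (x i).1 k0)) := by
  have : ∀ᶠ k in atTop, ∀ i, (x i).1 (k + 1) = e k ((x i).1 k) :=
    eventually_all.2 fun i => (x i).2
  obtain ⟨k0, h0⟩ := eventually_atTop.1 this
  refine ⟨k0, fun k hk => ?_⟩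
  induction k, hk using Nat.le_induction with
  | base => rfl
  | succ k hk ih =>
    rw [← ih, he k φ (fun i => (x i).1 k)]
    have : (fun i => (x i).1 (k + 1)) = fun i => e k ((x i).1 k) := funext (h0 k hk)
    rw [this]

theorem realize_lim {Γ : RelStruct σ ar D} (e : ℕ → D → D)
    (he : ∀ k, IsElementarySelfEmbedding Γ (e k)) {n : ℕ} (φ : FOFormula σ ar n) :
    ∀ (x : Fin n → Thread e),
    φ.Realize (lim Γ e) (fun i => Quotient.mk _ (x i)) ↔
      ∀ᶠ k in atTop, φ.Realize Γ (fun i => (x i).1 k) := by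
  induction φ with
  | eq i j =>
    intro x
    simp only [FOFormula.Realize]
    exact Quotient.eq (r := thrSetoid e)
  | rel s v =>
    intro x
    simp only [FOFormula.Realize, lim]
    refine eventually_congr ?_
    filter_upwards [ev_tuple e x] with k hk
    have : (fun m => (Quotient.mk (thrSetoid e) (x (v m))).out.1 k) = fun m => (x (v m)).1 k :=
      funext fun m => congrFun hk (v m)
    rw [this]
  | not φ ih =>
    intro x
    simp only [FOFormula.Realize]
    rw [ih x]
    obtain ⟨k0, h0⟩ := ev_const e he φ x
    have hev : ∀ᶠ k in atTop, (φ.Realize Γ (fun i => (x i).1 k) ↔ φ.Realize Γ (fun i => (x i).1 k0)) :=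
      eventually_atTop.2 ⟨k0, h0⟩
    rw [eventually_congr hev, eventually_congr (hev.mono fun k h => not_congr h)]
    rw [eventually_const, eventually_const]
  | and φ ψ ih1 ih2 =>
    intro x
    simp only [FOFormula.Realize]
    rw [ih1 x, ih2 x, eventually_and]
  | @ex n φ ih =>
    intro x
    have key : ∀ y : Thread e, (∀ k, (fun i => ((Fin.snoc x y : Fin (n + 1) → Thread e) i).1 k)
        = (Fin.snoc (fun i => (x i).1 k) (y.1 k) : Fin (n + 1) → D)) := by
      intro y k
      funext i
      refine Fin.lastCases ?_ (fun i => ?_) i <;> simp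
    have key2 : ∀ y : Thread e,
        (fun i => Quotient.mk (thrSetoid e) ((Fin.snoc x y : Fin (n + 1) → Thread e) i))
        = (Fin.snoc (fun i => Quotient.mk (thrSetoid e) (x i)) (Quotient.mk (thrSetoid e) y) :
          Fin (n + 1) → Quotient (thrSetoid e)) := by
      intro y
      funext i
      refine Fin.lastCases ?_ (fun i => ?_) i <;> simp
    simp only [FOFormula.Realize]
    constructor
    · rintro ⟨d, hd⟩
      obtain ⟨y, rfl⟩ := Quotient.exists_rep d
      rw [← key2, ih] at hd
      refine hd.mono fun k hk => ⟨y.1 k, ?_⟩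
      rw [← key]; exact hk
    · intro h
      have hx : ∀ᶠ k in atTop, ∀ i, (x i).1 (k + 1) = e k ((x i).1 k) :=
        eventually_all.2 fun i => (x i).2
      obtain ⟨k0, h0⟩ := eventually_atTop.1 (h.and hx)
      obtain ⟨d, hd⟩ := (h0 k0 le_rfl).1
      refine ⟨Quotient.mk _ (thread e k0 d), ?_⟩
      rw [← key2, ih]
      refine eventually_atTop.2 ⟨k0, fun k hk => ?_⟩
      rw [key]
      induction k, hk using Nat.le_induction with
      | base =>
        have : (thread e k0 d).1 k0 = d := thr_le e k0 d k0 le_rfl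
        rw [this]; exact hd
      | succ k hk ihk =>
        rw [he k φ] at ihk
        convert ihk using 1
        funext i
        refine Fin.lastCases ?_ (fun i => ?_) i
        · simp only [Fin.snoc_last]; exact thr_succ e k0 d k hk
        · simp only [Fin.snoc_castSucc]; exact (h0 k hk).2 i

/-- Limits of chains of endomorphisms. -/
theorem exists_limit {Γ : RelStruct σ ar D} (hcat : IsOmegaCategorical Γ)
    (hcore : IsModelCompleteCore Γ) (e : ℕ → D → D) (he : ∀ k, IsHom Γ Γ (e k)) :
    ∃ ι : ℕ → D → D, (∀ i, IsHom Γ Γ (ι i)) ∧ (∀ i d, ι (i + 1) (e i d) = ι i d) ∧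
      ∀ d, ∃ i0, ∀ i, i0 ≤ i → ∃ d', ι i d' = d := by
  have hc : Countable D := hcat.1
  have hcE : Countable (Quotient (thrSetoid e)) := by
    have : Function.Surjective (fun p : ℕ × D => Quotient.mk (thrSetoid e) (thread e p.1 p.2)) := by
      intro q
      obtain ⟨x, rfl⟩ := Quotient.exists_rep q
      obtain ⟨i0, h⟩ := exists_thread e x
      exact ⟨(i0, x.1 i0), h i0 le_rfl⟩
    exact this.countable
  have hel : ∀ k, IsElementarySelfEmbedding Γ (e k) := fun k => hcore _ (he k)
  obtain ⟨g, hg⟩ := hcat.2 _ (lim Γ e) hcE (by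
    intro φ hφ
    have := (realize_lim e hel φ (fun i => Fin.elim0 i)).2 (by
      refine Eventually.of_forall fun k => ?_
      convert hφ using 1)
    convert this using 1)
  refine ⟨fun i d => g.symm (Quotient.mk _ (thread e i d)), ?_, ?_, ?_⟩
  · intro i s t ht
    rw [hg]
    simp only [Equiv.apply_symm_apply]
    change ∀ᶠ k in atTop, _
    filter_upwards [ev_tuple e (fun m => thread e i (t m)), eventually_ge_atTop i] with k hk hik
    rw [hk]
    clear hk
    induction k, hik using Nat.le_induction with
    | base =>
      have : (fun m => (thread e i (t m)).1 i) = t := funext fun m => thr_le e i _ i le_rfl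
      rw [this]; exact ht
    | succ k hk ih =>
      have : (fun m => (thread e i (t m)).1 (k + 1)) = fun m => e k ((thread e i (t m)).1 k) :=
        funext fun m => thr_succ e i _ k hk
      rw [this]; exact he k s _ ih
  · intro i d
    refine congrArg g.symm (Quotient.sound ?_)
    change ∀ᶠ k in atTop, _
    filter_upwards [eventually_ge_atTop (i + 1)] with k hk
    refine thr_eq_of e _ _ (i + 1) (fun k hk => thr_succ e _ _ k hk)
      (fun k hk => thr_succ e _ _ k (by omega)) ?_ k hk
    change thr e (i + 1) (e i d) (i + 1) = thr e i d (i + 1)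
    rw [thr_le e _ _ _ le_rfl, thr_succ e i d i le_rfl, thr_le e i d i le_rfl]
  · intro d
    obtain ⟨x, hx⟩ := Quotient.exists_rep (g d)
    obtain ⟨i0, h⟩ := exists_thread e x
    refine ⟨i0, fun i hi => ⟨x.1 i, ?_⟩⟩
    exact (congrArg g.symm ((h i hi).trans hx)).trans (g.symm_apply_apply d)

theorem hom_id (Γ : RelStruct σ ar D) : IsHom Γ Γ id := fun _ _ h => h

theorem hom_comp {Γ : RelStruct σ ar D} {f g : D → D} (hf : IsHom Γ Γ f) (hg : IsHom Γ Γ g) :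
    IsHom Γ Γ (f ∘ g) := fun s t h => hf s _ (hg s t h)

def Good (Γ : RelStruct σ ar D) (l : List D) : Prop :=
  ∀ e, IsHom Γ Γ e → ∃ k, IsHom Γ Γ k ∧ (l.map e).map k = l

theorem Good.map {Γ : RelStruct σ ar D} {l : List D} (h : Good Γ l) {m : D → D}
    (hm : IsHom Γ Γ m) : Good Γ (l.map m) := by
  intro e he
  obtain ⟨k, hk, h2⟩ := h (e ∘ m) (hom_comp he hm)
  refine ⟨m ∘ k, hom_comp hm hk, ?_⟩
  conv_rhs => rw [← h2]
  simp

theorem exists_good {Γ : RelStruct σ ar D} (hcat : IsOmegaCategorical Γ)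
    (hcore : IsModelCompleteCore Γ) (l : List D) : ∃ e, IsHom Γ Γ e ∧ Good Γ (l.map e) := by
  classical
  have hc : Countable D := hcat.1
  obtain ⟨en, hen⟩ := exists_surjective_nat (List D)
  have step : ∀ (u v : List D), ∃ m, IsHom Γ Γ m ∧
      ((∃ m', IsHom Γ Γ m' ∧ u.map m' = v) → u.map m = v) := by
    intro u v
    by_cases h : ∃ m', IsHom Γ Γ m' ∧ u.map m' = v
    · obtain ⟨m, hm, h2⟩ := h
      exact ⟨m, hm, fun _ => h2⟩
    · exact ⟨id, hom_id Γ, fun h' => absurd h' h⟩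
  choose st hst hst2 using step
  let u : ℕ → List D := fun i => Nat.rec l (fun i v => v.map (st v (en i))) i
  have hu : ∀ i, u (i + 1) = (u i).map (st (u i) (en i)) := fun i => rfl
  obtain ⟨ι, h1, h2, -⟩ := exists_limit hcat hcore (fun i => st (u i) (en i)) (fun i => hst _ _)
  have h3 : ∀ i, (u i).map (ι i) = l.map (ι 0) := by
    intro i
    induction i with
    | zero => rfl
    | succ i ih =>
      rw [hu, ← ih, List.map_map]
      exact List.map_congr_left fun d _ => h2 i d
  refine ⟨ι 0, h1 0, ?_⟩
  intro e he
  obtain ⟨i, hi⟩ := hen ((l.map (ι 0)).map e)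
  refine ⟨ι (i + 1), h1 _, ?_⟩
  have : u (i + 1) = (l.map (ι 0)).map e := by
    rw [hu, ← hi]
    refine hst2 _ _ ⟨e ∘ ι i, hom_comp he (h1 i), ?_⟩
    rw [hi, ← h3 i]; simp
  rw [← this, h3]

theorem exists_all_good {Γ : RelStruct σ ar D} (hcat : IsOmegaCategorical Γ)
    (hcore : IsModelCompleteCore Γ) : ∃ e, IsHom Γ Γ e ∧ ∀ l : List D, Good Γ (l.map e) := by
  have hc : Countable D := hcat.1
  obtain ⟨en, hen⟩ := exists_surjective_nat (List D)
  choose G hG hG2 using exists_good hcat hcore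
  let c : ℕ → D → D := fun i => Nat.rec id (fun i f => G ((en i).map f) ∘ f) i
  have hcs : ∀ i, c (i + 1) = G ((en i).map (c i)) ∘ c i := fun i => rfl
  obtain ⟨ι, h1, h2, -⟩ := exists_limit hcat hcore (fun i => G ((en i).map (c i))) (fun i => hG _)
  have h3 : ∀ i d, ι i (c i d) = ι 0 d := by
    intro i d
    induction i with
    | zero => rfl
    | succ i ih => rw [← ih, ← h2 i, hcs]; rfl
  refine ⟨ι 0, h1 0, fun l => ?_⟩
  obtain ⟨i, rfl⟩ := hen l
  have := (hG2 ((en i).map (c i))).map (h1 (i + 1))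
  convert this using 1
  rw [List.map_map, List.map_map]
  refine List.map_congr_left fun d _ => ?_
  rw [← h3 (i + 1) d, hcs]; rfl

theorem all_good {Γ : RelStruct σ ar D} (hcat : IsOmegaCategorical Γ)
    (hcore : IsModelCompleteCore Γ) (l : List D) : Good Γ l := by
  obtain ⟨e, he, hg⟩ := exists_all_good hcat hcore
  obtain ⟨ι, h1, h2, h3⟩ := exists_limit hcat hcore (fun _ => e) (fun _ => he)
  have : ∃ i0, ∀ i, i0 ≤ i → ∃ l' : List D, l'.map (ι i) = l := by
    induction l with
    | nil => exact ⟨0, fun i _ => ⟨[], rfl⟩⟩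
    | cons d l ih =>
      obtain ⟨i0, h0⟩ := ih
      obtain ⟨i1, h4⟩ := h3 d
      refine ⟨max i0 i1, fun i hi => ?_⟩
      obtain ⟨l', hl'⟩ := h0 i (le_trans (le_max_left _ _) hi)
      obtain ⟨d', hd'⟩ := h4 i (le_trans (le_max_right _ _) hi)
      exact ⟨d' :: l', by simp [hl', hd']⟩
  obtain ⟨i, hi⟩ := this
  obtain ⟨l', rfl⟩ := hi i le_rfl
  have := (hg l').map (h1 (i + 1))
  convert this using 1
  rw [List.map_map]
  exact List.map_congr_left fun d _ => (h2 i d).symm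

theorem good_mem {Γ : RelStruct σ ar D} (hcat : IsOmegaCategorical Γ)
    (hcore : IsModelCompleteCore Γ) (l : List D) (e : D → D) (he : IsHom Γ Γ e) :
    ∃ k, IsHom Γ Γ k ∧ ∀ x ∈ l, k (e x) = x := by
  obtain ⟨k, hk, h⟩ := all_good hcat hcore l e he
  refine ⟨k, hk, fun x hx => ?_⟩
  rw [List.map_map] at h
  have h' : l.map (k ∘ e) = l.map id := by rw [h]; simp
  exact List.map_inj_left.1 h' x hx

def PI (Γ : RelStruct σ ar D) (p : List (D × D)) : Prop :=
  ∃ m, IsHom Γ Γ m ∧ ∀ q ∈ p, m q.1 = q.2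

theorem PI.symm {Γ : RelStruct σ ar D} (hcat : IsOmegaCategorical Γ)
    (hcore : IsModelCompleteCore Γ) {p : List (D × D)} (h : PI Γ p) :
    ∃ k, IsHom Γ Γ k ∧ ∀ q ∈ p, k q.2 = q.1 := by
  obtain ⟨m, hm, h⟩ := h
  obtain ⟨k, hk, h2⟩ := good_mem hcat hcore (p.map Prod.fst) m hm
  refine ⟨k, hk, fun q hq => ?_⟩
  rw [← h q hq]
  exact h2 _ (List.mem_map_of_mem hq)

theorem PI.ext {Γ : RelStruct σ ar D} (hcat : IsOmegaCategorical Γ)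
    (hcore : IsModelCompleteCore Γ) {p : List (D × D)} (h : PI Γ p) (c : D) :
    ∃ p', PI Γ p' ∧ (∀ q ∈ p, q ∈ p') ∧ (∃ y, (c, y) ∈ p') ∧ ∃ x, (x, c) ∈ p' := by
  obtain ⟨m, hm, h1⟩ := h
  have hp1 : PI Γ ((c, m c) :: p) := ⟨m, hm, by simpa using fun a b => h1 (a, b)⟩
  obtain ⟨k, hk, h2⟩ := hp1.symm hcat hcore
  obtain ⟨m', hm', h3⟩ := good_mem hcat hcore (c :: ((c, m c) :: p).map Prod.snd) k hk
  refine ⟨(k c, c) :: (c, m c) :: p, ⟨m', hm', ?_⟩, ?_, ⟨m c, by simp⟩, ⟨k c, by simp⟩⟩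
  · intro q hq
    rcases List.mem_cons.1 hq with rfl | hq
    · exact h3 c (by simp)
    · rw [← h2 q hq]
      exact h3 _ (List.mem_cons_of_mem _ (List.mem_map_of_mem hq))
  · intro q hq; simp [hq]

theorem exists_aut {Γ : RelStruct σ ar D} (hcat : IsOmegaCategorical Γ)
    (hcore : IsModelCompleteCore Γ) {p : List (D × D)} (h : PI Γ p) :
    ∃ α β, IsHom Γ Γ α ∧ IsHom Γ Γ β ∧ (∀ x, β (α x) = x) ∧ ∀ q ∈ p, α q.1 = q.2 := by
  have hc : Countable D := hcat.1
  rcases isEmpty_or_nonempty D with hE | hN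
  · exact ⟨id, id, hom_id Γ, hom_id Γ, fun _ => rfl, fun q => (hE.false q.1).elim⟩
  obtain ⟨en, hen⟩ := exists_surjective_nat D
  have step : ∀ (P : {p // PI Γ p}) (c : D), ∃ P' : {p // PI Γ p},
      (∀ q ∈ P.1, q ∈ P'.1) ∧ (∃ y, (c, y) ∈ P'.1) ∧ ∃ x, (x, c) ∈ P'.1 := by
    intro P c
    obtain ⟨p', h1, h2⟩ := P.2.ext hcat hcore c
    exact ⟨⟨p', h1⟩, h2⟩
  choose nx hn1 hn2 hn3 using step
  let s : ℕ → {p // PI Γ p} := fun i => Nat.rec ⟨p, h⟩ (fun i P => nx P (en i)) i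
  have hs : ∀ i, s (i + 1) = nx (s i) (en i) := fun i => rfl
  have mono : ∀ i j, i ≤ j → ∀ q ∈ (s i).1, q ∈ (s j).1 := by
    intro i j hij
    induction j, hij using Nat.le_induction with
    | base => exact fun q hq => hq
    | succ j _ ih => exact fun q hq => by rw [hs]; exact hn1 _ _ q (ih q hq)
  have ex1 : ∀ x, ∃ y, ∃ i, (x, y) ∈ (s i).1 := by
    intro x
    obtain ⟨i, rfl⟩ := hen x
    obtain ⟨y, hy⟩ := hn2 (s i) (en i)
    exact ⟨y, i + 1, hy⟩
  have ex2 : ∀ y, ∃ x, ∃ i, (x, y) ∈ (s i).1 := by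
    intro x
    obtain ⟨i, rfl⟩ := hen x
    obtain ⟨y, hy⟩ := hn3 (s i) (en i)
    exact ⟨y, i + 1, hy⟩
  choose α ia hα using ex1
  choose β ib hβ using ex2
  refine ⟨α, β, ?_, ?_, ?_, ?_⟩
  · intro r t ht
    obtain ⟨N, hN⟩ := (Set.finite_range fun m => ia (t m)).bddAbove
    obtain ⟨m, hm, h1⟩ := (s N).2
    have : (fun i => α (t i)) = fun i => m (t i) := by
      funext i
      exact (h1 _ (mono _ _ (hN ⟨i, rfl⟩) _ (hα (t i)))).symm
    rw [this]; exact hm r t ht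
  · intro r t ht
    obtain ⟨N, hN⟩ := (Set.finite_range fun m => ib (t m)).bddAbove
    obtain ⟨m, hm, h1⟩ := (s N).2.symm hcat hcore
    have : (fun i => β (t i)) = fun i => m (t i) := by
      funext i
      exact (h1 _ (mono _ _ (hN ⟨i, rfl⟩) _ (hβ (t i)))).symm
    rw [this]; exact hm r t ht
  · intro x
    obtain ⟨m, hm, h1⟩ := (s (max (ia x) (ib (α x)))).2.symm hcat hcore
    have e1 := h1 _ (mono _ _ (le_max_left _ _) _ (hα x))
    have e2 := h1 _ (mono _ _ (le_max_right _ _) _ (hβ (α x)))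
    exact e2.symm.trans e1
  · intro q hq
    obtain ⟨m, hm, h1⟩ := (s (ia q.1)).2
    have e1 := h1 _ (hα q.1)
    have e2 := h1 _ (mono 0 _ (Nat.zero_le _) q hq)
    exact e1.symm.trans e2

theorem hom_const {Γ : RelStruct σ ar D} {n : ℕ} {a : Fin n → D} {e : D → D}
    (he : IsHom Γ Γ e) (ha : ∀ i, e (a i) = a i) : IsEndomorphism (Γ.withConstants a) e := by
  intro s t ht
  cases s with
  | inl s => exact he s t ht
  | inr i =>
    have : t (0 : Fin 1) = a i := ht
    exact (congrArg e this).trans (ha i)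

end SymPol

/-- **Symmetric polymorphisms modulo endomorphisms survive expansion by constants.**
Let `Γ` be an ω-categorical model-complete core that has a symmetric polymorphism
modulo endomorphisms. Then for all elements `a₁, …, a_n` of `Γ`, the expansion
`(Γ, a₁, …, a_n)` also has a symmetric polymorphism modulo endomorphisms. -/
theorem symmetric_polymorphism_of_expansion_by_constants
    (σ : Type) (ar : σ → ℕ) (D : Type) (Γ : RelStruct σ ar D)
    (hcat : IsOmegaCategorical Γ) (hcore : IsModelCompleteCore Γ)
    (hsym : HasSymmetricPolymorphismModEndos Γ)
    (n : ℕ) (a : Fin n → D) :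
    HasSymmetricPolymorphismModEndos (Γ.withConstants a) := by
  obtain ⟨f, e₁, e₂, hf, he₁, he₂, hfe⟩ := hsym
  have hδ : IsHom Γ Γ (fun x => f x x) := fun s t ht => hf s (fun _ => t) (fun _ => ht)
  obtain ⟨k, hk, hka⟩ := SymPol.good_mem hcat hcore (List.ofFn a) _ hδ
  have hPI : SymPol.PI Γ ((List.ofFn a).map fun x => (f x x, x)) := by
    refine ⟨k, hk, fun q hq => ?_⟩
    obtain ⟨x, hx, rfl⟩ := List.mem_map.1 hq
    exact hka x hx
  obtain ⟨α, β, hα, hβ, hβα, hαp⟩ := SymPol.exists_aut hcat hcore hPI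
  have hαa : ∀ i, α (f (a i) (a i)) = a i := fun i =>
    hαp (f (a i) (a i), a i) (List.mem_map.2 ⟨a i, by simp, rfl⟩)
  have hu₁ : IsHom Γ Γ (e₁ ∘ β) := SymPol.hom_comp he₁ hβ
  have hu₂ : IsHom Γ Γ (e₂ ∘ β) := SymPol.hom_comp he₂ hβ
  obtain ⟨γ, hγ, hγa⟩ := SymPol.good_mem hcat hcore (List.ofFn a) _ hu₁
  have h1 : ∀ i, (γ ∘ (e₁ ∘ β)) (a i) = a i := fun i => hγa (a i) (by simp)
  have h12 : ∀ x y, e₁ (β (α (f x y))) = e₂ (β (α (f y x))) := fun x y => by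
    rw [hβα, hβα, hfe]
  have h2 : ∀ i, (γ ∘ (e₂ ∘ β)) (a i) = a i := fun i => by
    have := h12 (a i) (a i)
    rw [hαa] at this
    have h3 := h1 i
    simp only [Function.comp] at h3 ⊢
    rw [← this, h3]
  refine ⟨fun x y => α (f x y), γ ∘ (e₁ ∘ β), γ ∘ (e₂ ∘ β), ?_,
    SymPol.hom_const (SymPol.hom_comp hγ hu₁) h1, SymPol.hom_const (SymPol.hom_comp hγ hu₂) h2, fun x y => ?_⟩
  · intro s ts hts
    cases s with
    | inl s => exact hα s _ (hf s ts hts)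
    | inr i =>
      have e0 : ts 0 (0 : Fin 1) = a i := hts 0
      have e1 : ts 1 (0 : Fin 1) = a i := hts 1
      change α (f (ts 0 (0 : Fin 1)) (ts 1 (0 : Fin 1))) = a i
      rw [e0, e1, hαa]
  · exact congrArg γ (h12 x y)
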